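/- Let A and B be unital locally matrix algebras over a field F, each of dimension at most ℵ₀ over F. Then A and B are isomorphic as F-algebras if and only if st(A) = st(B), i.e., {m : m divides some d ∈ D(A)} = {m : m divides some d ∈ D(B)}. -/

import Mathlib

/-- A unital locally matrix algebra over a field `F`: every finite subset lies in a
unital subalgebra (automatically containing `1`) isomorphic to a full matrix algebra
`M_n(F)` for some `n ≥ 1`. -/
def IsUnitalLocallyMatrix (F : Type*) [Field F] (A : Type*) [Ring A] [Algebra F A] : Prop :=
  ∀ s : Finset A, ∃ (n : ℕ) (B : Subalgebra F A), 1 ≤ n ∧ (↑s : Set A) ⊆ B ∧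
    Nonempty (B ≃ₐ[F] Matrix (Fin n) (Fin n) F)

/-- `D(A)`: the set of positive integers `n` such that `A` has a unital subalgebra
(containing `1`) isomorphic to `M_n(F)`. -/
def matrixDegrees (F : Type*) [Field F] (A : Type*) [Ring A] [Algebra F A] : Set ℕ :=
  {n | 1 ≤ n ∧ ∃ B : Subalgebra F A, Nonempty (B ≃ₐ[F] Matrix (Fin n) (Fin n) F)}

section MatrixRepresentations

variable {F : Type*} [Field F] {V : Type*} [AddCommGroup V] [Module F V] {ι : Type*} [Fintype ι]
  [DecidableEq ι]

/-- A representation of a full matrix algebra is a direct power of the range of a diagonal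
matrix unit, with matrix units permuting the factors. -/
theorem exists_pi_linearEquiv_of_matrix_representation (i₀ : ι)
    (ρ : Matrix ι ι F →ₐ[F] Module.End F V) :
    ∃ e : (ι → LinearMap.range (ρ (Matrix.single i₀ i₀ 1))) ≃ₗ[F] V,
      ∀ i j w, ρ (Matrix.single i j 1) (e w) = e (Pi.single i (w j)) := by
  have hmul : ∀ i j k l (v : V), ρ (Matrix.single i j 1) (ρ (Matrix.single k l 1) v) =
      if j = k then ρ (Matrix.single i l 1) v else 0 := by
    intro i j k l v
    rw [← Module.End.mul_apply, ← map_mul]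
    split_ifs with h
    · subst h
      simp
    · rw [Matrix.single_mul_single_of_ne _ _ _ _ h]
      simp
  have hW : ∀ w : LinearMap.range (ρ (Matrix.single i₀ i₀ 1)),
      ρ (Matrix.single i₀ i₀ 1) (w : V) = w := by
    rintro ⟨_, v, rfl⟩
    simp [hmul]
  have hone : ∀ v : V, ∑ i, ρ (Matrix.single i i 1) v = v := by
    intro v
    rw [← LinearMap.sum_apply, ← map_sum, Matrix.sum_single_one, map_one, Module.End.one_apply]
  let toV : (ι → LinearMap.range (ρ (Matrix.single i₀ i₀ 1))) →ₗ[F] V :=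
    ∑ i, (ρ (Matrix.single i i₀ 1)) ∘ₗ (Submodule.subtype _) ∘ₗ (LinearMap.proj i)
  have htoV : ∀ w, toV w = ∑ i, ρ (Matrix.single i i₀ 1) (w i : V) := by
    intro w
    simp [toV, LinearMap.sum_apply]
  let ofV : V →ₗ[F] (ι → LinearMap.range (ρ (Matrix.single i₀ i₀ 1))) :=
    LinearMap.pi fun i ↦ (ρ (Matrix.single i₀ i 1)).codRestrict _ fun v ↦
      ⟨ρ (Matrix.single i₀ i 1) v, by simp [hmul]⟩
  have hofV : ∀ v i, (ofV v i : V) = ρ (Matrix.single i₀ i 1) v := fun _ _ ↦ rfl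
  have h₁ : ∀ v, toV (ofV v) = v := by
    intro v
    rw [htoV]
    simp [hofV, hmul, hone]
  have h₂ : ∀ w, ofV (toV w) = w := by
    intro w
    ext i
    rw [hofV, htoV, map_sum]
    simp [hmul, hW]
  refine ⟨LinearEquiv.ofLinearMap toV ofV (LinearMap.ext h₁) (LinearMap.ext h₂), fun i j w ↦ ?_⟩
  change ρ (Matrix.single i j 1) (toV w) = toV (Pi.single i (w j))
  rw [htoV, htoV, map_sum]
  simp only [hmul]
  rw [Finset.sum_ite_eq]
  rw [Finset.sum_eq_single i]
  · simp
  · intro k _ hk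
    simp [Pi.single_eq_of_ne hk]
  · simp

theorem card_dvd_finrank_of_matrix_representation [Nonempty ι] [FiniteDimensional F V]
    (ρ : Matrix ι ι F →ₐ[F] Module.End F V) : Fintype.card ι ∣ Module.finrank F V := by
  obtain ⟨e, -⟩ := exists_pi_linearEquiv_of_matrix_representation (Classical.arbitrary ι) ρ
  rw [← e.finrank_eq, Module.finrank_pi_fintype]
  simp

/-- Any two representations of a full matrix algebra on the same space are conjugate. -/
theorem exists_linearEquiv_intertwining_matrix_representations [Nonempty ι]
    [FiniteDimensional F V] (ρ σ : Matrix ι ι F →ₐ[F] Module.End F V) :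
    ∃ u : V ≃ₗ[F] V, ∀ x v, u (ρ x v) = σ x (u v) := by
  obtain ⟨e, he⟩ := exists_pi_linearEquiv_of_matrix_representation (Classical.arbitrary ι) ρ
  obtain ⟨e', he'⟩ := exists_pi_linearEquiv_of_matrix_representation (Classical.arbitrary ι) σ
  have hfin := e.finrank_eq.trans e'.finrank_eq.symm
  rw [Module.finrank_pi_fintype, Module.finrank_pi_fintype, Finset.sum_const, Finset.sum_const,
    smul_eq_mul, smul_eq_mul] at hfin
  have h := LinearEquiv.ofFinrankEq _ _
    (Nat.eq_of_mul_eq_mul_left (Finset.card_pos.2 Finset.univ_nonempty) hfin)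
  let u := e.symm.trans ((LinearEquiv.piCongrRight fun _ : ι ↦ h).trans e')
  have hu : ∀ w, u (e w) = e' (fun i ↦ h (w i)) := by
    intro w
    simp only [u, LinearEquiv.trans_apply, LinearEquiv.symm_apply_apply]
    rfl
  refine ⟨u, fun x v ↦ ?_⟩
  obtain ⟨w, rfl⟩ := e.surjective v
  induction x using Matrix.induction_on' with
  | h_zero => simp
  | h_add p q hp hq => simp only [map_add, LinearMap.add_apply, hp, hq]
  | h_std_basis i j c =>
    have hc : Matrix.single i j c = c • Matrix.single i j (1 : F) := by simp
    rw [hc, map_smul, map_smul, LinearMap.smul_apply, LinearMap.smul_apply, map_smul, he, hu, hu,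
      he']
    congr 2
    ext k
    by_cases hk : k = i
    · subst hk
      simp
    · simp [Pi.single_eq_of_ne hk]

end MatrixRepresentations

section MatrixAlgebras

variable {F : Type*} [Field F]

theorem Matrix.dvd_of_algHom {m n : ℕ} (hm : 1 ≤ m)
    (f : Matrix (Fin m) (Fin m) F →ₐ[F] Matrix (Fin n) (Fin n) F) : m ∣ n := by
  have : NeZero m := ⟨by lia⟩
  simpa using card_dvd_finrank_of_matrix_representation
    ((Matrix.toLinAlgEquiv' (R := F) (n := Fin n)).toAlgHom.comp f)

theorem Matrix.nonempty_algHom_of_dvd {m n : ℕ} (h : m ∣ n) :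
    Nonempty (Matrix (Fin m) (Fin m) F →ₐ[F] Matrix (Fin n) (Fin n) F) := by
  obtain ⟨k, rfl⟩ := h
  exact ⟨(Matrix.reindexAlgEquiv F F finProdFinEquiv).toAlgHom.comp
    ((Matrix.kroneckerAlgEquiv (Fin m) (Fin k) F).toAlgHom.comp
      Algebra.TensorProduct.includeLeft)⟩

/-- Any two homomorphisms between full matrix algebras are conjugate. -/
theorem Matrix.exists_unit_conj_of_algHom {m n : ℕ} (hm : 1 ≤ m)
    (f g : Matrix (Fin m) (Fin m) F →ₐ[F] Matrix (Fin n) (Fin n) F) :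
    ∃ u : (Matrix (Fin n) (Fin n) F)ˣ, ∀ x, g x * u = u * f x := by
  have : NeZero m := ⟨by lia⟩
  let t := Matrix.toLinAlgEquiv' (R := F) (n := Fin n)
  obtain ⟨u, hu⟩ := exists_linearEquiv_intertwining_matrix_representations
    (t.toAlgHom.comp f) (t.toAlgHom.comp g)
  let U : (Module.End F (Fin n → F))ˣ := LinearMap.GeneralLinearGroup.ofLinearEquiv u
  let u' : (Matrix (Fin n) (Fin n) F)ˣ := Units.map (t.symm : _ →* _) U
  refine ⟨u', fun x ↦ ?_⟩
  apply t.injective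
  rw [map_mul, map_mul]
  have hU : t (u' : Matrix (Fin n) (Fin n) F) = u.toLinearMap := t.apply_symm_apply _
  rw [hU]
  exact LinearMap.ext fun v ↦ (hu x v).symm

/-- An algebra isomorphic to a full matrix algebra of positive degree over the base field. -/
def IsMatrixAlgebra (F : Type*) [Field F] (R : Type*) [Ring R] [Algebra F R] : Prop :=
  ∃ n : ℕ, 1 ≤ n ∧ Nonempty (R ≃ₐ[F] Matrix (Fin n) (Fin n) F)

namespace IsMatrixAlgebra

variable {R S : Type*} [Ring R] [Ring S] [Algebra F R] [Algebra F S]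

theorem of_algEquiv (h : IsMatrixAlgebra F R) (e : R ≃ₐ[F] S) : IsMatrixAlgebra F S := by
  obtain ⟨n, hn, ⟨f⟩⟩ := h
  exact ⟨n, hn, ⟨e.symm.trans f⟩⟩

theorem finite (h : IsMatrixAlgebra F R) : Module.Finite F R := by
  obtain ⟨n, -, ⟨f⟩⟩ := h
  exact Module.Finite.equiv f.symm.toLinearEquiv

theorem injective (h : IsMatrixAlgebra F R) [Nontrivial S] (f : R →ₐ[F] S) :
    Function.Injective f := by
  obtain ⟨n, hn, ⟨e⟩⟩ := h
  have : NeZero n := ⟨by lia⟩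
  have hinj : Function.Injective (f.comp e.symm.toAlgHom) :=
    RingHom.injective (f.comp e.symm.toAlgHom).toRingHom
  intro x y hxy
  apply e.injective
  apply hinj
  simpa using hxy

theorem exists_unit_conj (hR : IsMatrixAlgebra F R) (hS : IsMatrixAlgebra F S)
    (f g : R →ₐ[F] S) : ∃ u : Sˣ, ∀ x, g x = u * f x * ↑u⁻¹ := by
  obtain ⟨m, hm, ⟨e⟩⟩ := hR
  obtain ⟨n, -, ⟨e'⟩⟩ := hS
  obtain ⟨u, hu⟩ := Matrix.exists_unit_conj_of_algHom hm
    (e'.toAlgHom.comp (f.comp e.symm.toAlgHom)) (e'.toAlgHom.comp (g.comp e.symm.toAlgHom))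
  refine ⟨Units.map (e'.symm : _ →* _) u, fun x ↦ ?_⟩
  rw [Units.eq_mul_inv_iff_mul_eq]
  apply e'.injective
  simpa using hu (e x)

/-- A homomorphism from a matrix subalgebra extends along any embedding, provided the
larger algebra maps to the target at all. -/
theorem exists_algHom_extension {T : Type*} [Ring T] [Algebra F T]
    (hR : IsMatrixAlgebra F R) (hT : IsMatrixAlgebra F T)
    (i : R →ₐ[F] S) (g : R →ₐ[F] T) (f : S →ₐ[F] T) :
    ∃ f' : S →ₐ[F] T, ∀ x, f' (i x) = g x := by
  obtain ⟨u, hu⟩ := hR.exists_unit_conj hT (f.comp i) g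
  refine ⟨(MulSemiringAction.toAlgEquiv F T (ConjAct.toConjAct u)).toAlgHom.comp f, fun x ↦ ?_⟩
  rw [hu x]
  simp [ConjAct.units_smul_def]

end IsMatrixAlgebra

end MatrixAlgebras

section LocallyMatrix

variable {F : Type*} [Field F] {A B : Type*} [Ring A] [Ring B] [Algebra F A] [Algebra F B]

theorem IsUnitalLocallyMatrix.nontrivial (hA : IsUnitalLocallyMatrix F A) : Nontrivial A := by
  obtain ⟨n, C, hn, -, ⟨e⟩⟩ := hA ∅
  have : NeZero n := ⟨by lia⟩
  have : Nontrivial C := e.toEquiv.nontrivial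
  exact Subtype.val_injective.nontrivial (α := C)

theorem IsUnitalLocallyMatrix.exists_le (hA : IsUnitalLocallyMatrix F A) (C D : Subalgebra F A)
    [Module.Finite F C] [Module.Finite F D] :
    ∃ (n : ℕ) (E : Subalgebra F A), 1 ≤ n ∧ C ≤ E ∧ D ≤ E ∧
      Nonempty (E ≃ₐ[F] Matrix (Fin n) (Fin n) F) := by
  classical
  obtain ⟨s, hs⟩ : C.toSubmodule.FG := Module.Finite.iff_fg.1 ‹_›
  obtain ⟨t, ht⟩ : D.toSubmodule.FG := Module.Finite.iff_fg.1 ‹_›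
  obtain ⟨n, E, hn, hE, e⟩ := hA (s ∪ t)
  rw [Finset.coe_union, Set.union_subset_iff] at hE
  refine ⟨n, E, hn, ?_, ?_, e⟩
  · rw [← Subalgebra.toSubmodule.le_iff_le, ← hs]
    exact Submodule.span_le.2 hE.1
  · rw [← Subalgebra.toSubmodule.le_iff_le, ← ht]
    exact Submodule.span_le.2 hE.2

theorem matrixDegrees_subset_of_algEquiv (e : A ≃ₐ[F] B) :
    matrixDegrees F A ⊆ matrixDegrees F B := by
  rintro n ⟨hn, C, ⟨f⟩⟩
  exact ⟨hn, C.map (e : A →ₐ[F] B),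
    ⟨(C.equivMapOfInjective (e : A →ₐ[F] B) e.injective).symm.trans f⟩⟩

theorem matrixDegrees_eq_of_algEquiv (e : A ≃ₐ[F] B) :
    matrixDegrees F A = matrixDegrees F B :=
  (matrixDegrees_subset_of_algEquiv e).antisymm (matrixDegrees_subset_of_algEquiv e.symm)

/-- Any isomorphism between matrix subalgebras, given by its graph, can be extended so that its
domain contains a prescribed element. -/
theorem exists_isMatrixAlgebra_graph_extension (hA : IsUnitalLocallyMatrix F A)
    (hB : IsUnitalLocallyMatrix F B)
    (hdvd : ∀ d ∈ matrixDegrees F A, ∃ d' ∈ matrixDegrees F B, d ∣ d')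
    (P : Subalgebra F (A × B)) (hP : IsMatrixAlgebra F P) (a : A) :
    ∃ Q : Subalgebra F (A × B), IsMatrixAlgebra F Q ∧ P ≤ Q ∧ ∃ q ∈ Q, q.1 = a := by
  have := hP.finite
  have := hA.nontrivial
  have := hB.nontrivial
  obtain ⟨k, C₀, hk, hC₀, ⟨e₀⟩⟩ := hA {a}
  have : Module.Finite F C₀ := IsMatrixAlgebra.finite ⟨k, hk, ⟨e₀⟩⟩
  have : Module.Finite F (P.map (AlgHom.fst F A B)) :=
    Module.Finite.map P.toSubmodule (AlgHom.fst F A B).toLinearMap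
  have : Module.Finite F (P.map (AlgHom.snd F A B)) :=
    Module.Finite.map P.toSubmodule (AlgHom.snd F A B).toLinearMap
  obtain ⟨n, A', hn, hPA, haA, ⟨eA⟩⟩ := hA.exists_le (P.map (AlgHom.fst F A B)) C₀
  obtain ⟨d, ⟨hd, D, ⟨eD⟩⟩, hnd⟩ := hdvd n ⟨hn, A', ⟨eA⟩⟩
  have : Module.Finite F D := IsMatrixAlgebra.finite ⟨d, hd, ⟨eD⟩⟩
  obtain ⟨r, B', hr, hPB, hDB, ⟨eB⟩⟩ := hB.exists_le (P.map (AlgHom.snd F A B)) D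
  have hdr : d ∣ r := Matrix.dvd_of_algHom hd
    (eB.toAlgHom.comp ((Subalgebra.inclusion hDB).comp eD.symm.toAlgHom))
  obtain ⟨φ⟩ := Matrix.nonempty_algHom_of_dvd (F := F) (hnd.trans hdr)
  let i : P →ₐ[F] A' := ((AlgHom.fst F A B).comp P.val).codRestrict A'
    fun x ↦ hPA ⟨x, x.2, rfl⟩
  let g : P →ₐ[F] B' := ((AlgHom.snd F A B).comp P.val).codRestrict B'
    fun x ↦ hPB ⟨x, x.2, rfl⟩
  obtain ⟨ψ, hψ⟩ := hP.exists_algHom_extension ⟨r, hr, ⟨eB⟩⟩ i g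
    (eB.symm.toAlgHom.comp (φ.comp eA.toAlgHom))
  let γ : A' →ₐ[F] A × B := A'.val.prod (B'.val.comp ψ)
  have hγ : Function.Injective γ := fun x y hxy ↦ Subtype.ext (congrArg Prod.fst hxy)
  refine ⟨γ.range, IsMatrixAlgebra.of_algEquiv ⟨n, hn, ⟨eA⟩⟩ (AlgEquiv.ofInjective γ hγ),
    fun p hp ↦ ⟨i ⟨p, hp⟩, ?_⟩, γ ⟨a, haA (hC₀ (by simp))⟩, ⟨_, rfl⟩, rfl⟩
  exact Prod.ext rfl (congrArg Subtype.val (hψ ⟨p, hp⟩))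

theorem exists_isMatrixAlgebra_graph_extension_right (hA : IsUnitalLocallyMatrix F A)
    (hB : IsUnitalLocallyMatrix F B)
    (hdvd : ∀ d ∈ matrixDegrees F B, ∃ d' ∈ matrixDegrees F A, d ∣ d')
    (P : Subalgebra F (A × B)) (hP : IsMatrixAlgebra F P) (b : B) :
    ∃ Q : Subalgebra F (A × B), IsMatrixAlgebra F Q ∧ P ≤ Q ∧ ∃ q ∈ Q, q.2 = b := by
  let s : A × B →ₐ[F] B × A := (AlgHom.snd F A B).prod (AlgHom.fst F A B)
  let s' : B × A →ₐ[F] A × B := (AlgHom.snd F B A).prod (AlgHom.fst F B A)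
  have hs : Function.Injective s := Prod.swap_injective
  have hs' : Function.Injective s' := Prod.swap_injective
  obtain ⟨Q, hQ, hPQ, q, hq, hqb⟩ := exists_isMatrixAlgebra_graph_extension hB hA hdvd (P.map s)
    (hP.of_algEquiv (P.equivMapOfInjective s hs)) b
  exact ⟨Q.map s', hQ.of_algEquiv (Q.equivMapOfInjective s' hs'),
    fun p hp ↦ ⟨s p, hPQ ⟨p, hp, rfl⟩, rfl⟩, s' q, ⟨q, hq, rfl⟩, hqb⟩

theorem countable_chooseBasisIndex_of_rank_le_aleph0 (h : Module.rank F A ≤ Cardinal.aleph0) :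
    Countable (Module.Free.ChooseBasisIndex F A) := by
  rwa [← Cardinal.mk_le_aleph0_iff, ← Module.Free.rank_eq_card_chooseBasisIndex F A]

theorem injective_of_directed_isMatrixAlgebra [Nontrivial B] {ι : Type*} [Nonempty ι]
    {S : ι → Subalgebra F A} (hdir : Directed (· ≤ ·) S) (hS : ∀ i, IsMatrixAlgebra F (S i))
    (f : A →ₐ[F] B) : Function.Injective (f.comp (⨆ i, S i).val) := by
  rw [injective_iff_map_eq_zero]
  rintro ⟨x, hx⟩ h
  have hx' := hx
  rw [← SetLike.mem_coe, Subalgebra.coe_iSup_of_directed hdir, Set.mem_iUnion] at hx'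
  obtain ⟨i, hi⟩ := hx'
  have h₀ : (⟨x, hi⟩ : S i) = 0 :=
    (hS i).injective (f.comp (S i).val) (by rw [map_zero]; exact h)
  exact Subtype.ext (congrArg Subtype.val h₀ :)

theorem nonempty_algEquiv_of_matrixDegrees_dvd (hA : IsUnitalLocallyMatrix F A)
    (hB : IsUnitalLocallyMatrix F B)
    (hdimA : Module.rank F A ≤ Cardinal.aleph0) (hdimB : Module.rank F B ≤ Cardinal.aleph0)
    (hAB : ∀ d ∈ matrixDegrees F A, ∃ d' ∈ matrixDegrees F B, d ∣ d')
    (hBA : ∀ d ∈ matrixDegrees F B, ∃ d' ∈ matrixDegrees F A, d ∣ d') :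
    Nonempty (A ≃ₐ[F] B) := by
  have := hA.nontrivial
  have := hB.nontrivial
  have := countable_chooseBasisIndex_of_rank_le_aleph0 hdimA
  have := countable_chooseBasisIndex_of_rank_le_aleph0 hdimB
  let bA := Module.Free.chooseBasis F A
  let bB := Module.Free.chooseBasis F B
  have := Encodable.ofCountable (Module.Free.ChooseBasisIndex F A)
  have := Encodable.ofCountable (Module.Free.ChooseBasisIndex F B)
  let T := {P : Subalgebra F (A × B) // IsMatrixAlgebra F P}
  let P₀ : T := ⟨⊥, 1, le_rfl, ⟨(Algebra.botEquiv F (A × B)).trans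
    (AlgEquiv.ofBijective (Algebra.ofId F (Matrix (Fin 1) (Fin 1) F))
      ⟨(algebraMap F _).injective, fun M ↦ ⟨M 0 0, by
        ext i j
        fin_cases i, j
        simp [Algebra.ofId_apply, Matrix.algebraMap_matrix_apply]⟩⟩)⟩⟩
  let cof : Module.Free.ChooseBasisIndex F A ⊕ Module.Free.ChooseBasisIndex F B →
      Order.Cofinal T := Sum.elim
    (fun i ↦ ⟨{Q | ∃ q ∈ Q.1, q.1 = bA i}, fun P ↦
      let ⟨Q, hQ, hPQ, hq⟩ := exists_isMatrixAlgebra_graph_extension hA hB hAB P.1 P.2 (bA i)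
      ⟨⟨Q, hQ⟩, hq, hPQ⟩⟩)
    (fun i ↦ ⟨{Q | ∃ q ∈ Q.1, q.2 = bB i}, fun P ↦
      let ⟨Q, hQ, hPQ, hq⟩ :=
        exists_isMatrixAlgebra_graph_extension_right hA hB hBA P.1 P.2 (bB i)
      ⟨⟨Q, hQ⟩, hq, hPQ⟩⟩)
  let I := Order.idealOfCofinals P₀ cof
  let G : Subalgebra F (A × B) := ⨆ Q : I, Q.1.1
  have : Nonempty I := I.nonempty.to_subtype
  have hdir : Directed (· ≤ ·) fun Q : I ↦ Q.1.1 := fun Q R ↦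
    let ⟨S, hS, hQS, hRS⟩ := I.directed Q.1 Q.2 R.1 R.2
    ⟨⟨S, hS⟩, hQS, hRS⟩
  have hle : ∀ Q ∈ I, Q.1 ≤ G := fun Q hQ ↦ le_iSup (fun Q : I ↦ Q.1.1) ⟨Q, hQ⟩
  let p : G →ₐ[F] A := (AlgHom.fst F A B).comp G.val
  let q : G →ₐ[F] B := (AlgHom.snd F A B).comp G.val
  have hp : Function.Bijective p := by
    constructor
    · exact injective_of_directed_isMatrixAlgebra hdir (fun Q ↦ Q.1.2) (AlgHom.fst F A B)
    · rw [← AlgHom.coe_toLinearMap, ← LinearMap.range_eq_top, eq_top_iff, ← bA.span_eq,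
        Submodule.span_le]
      rintro _ ⟨i, rfl⟩
      obtain ⟨Q, ⟨x, hx, hxi⟩, hQ⟩ := Order.cofinal_meets_idealOfCofinals P₀ cof (Sum.inl i)
      exact ⟨⟨x, hle Q hQ hx⟩, hxi⟩
  have hq : Function.Bijective q := by
    constructor
    · exact injective_of_directed_isMatrixAlgebra hdir (fun Q ↦ Q.1.2) (AlgHom.snd F A B)
    · rw [← AlgHom.coe_toLinearMap, ← LinearMap.range_eq_top, eq_top_iff, ← bB.span_eq,
        Submodule.span_le]
      rintro _ ⟨i, rfl⟩
      obtain ⟨Q, ⟨x, hx, hxi⟩, hQ⟩ := Order.cofinal_meets_idealOfCofinals P₀ cof (Sum.inr i)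
      exact ⟨⟨x, hle Q hQ hx⟩, hxi⟩
  exact ⟨(AlgEquiv.ofBijective p hp).symm.trans (AlgEquiv.ofBijective q hq)⟩

end LocallyMatrix

/-- Glimm's theorem: unital locally matrix algebras of countable dimension are
isomorphic if and only if their Steinitz numbers coincide, encoded by equality of the
divisor sets of `D(A)` and `D(B)`. -/
theorem isomorphic_iff_steinitz_eq
    (F : Type*) [Field F]
    (A : Type u) (B : Type v) [Ring A] [Ring B] [Algebra F A] [Algebra F B]
    (hA : IsUnitalLocallyMatrix F A) (hB : IsUnitalLocallyMatrix F B)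
    (hdimA : Module.rank F A ≤ Cardinal.aleph0)
    (hdimB : Module.rank F B ≤ Cardinal.aleph0) :
    Nonempty (A ≃ₐ[F] B) ↔
      {m : ℕ | ∃ d ∈ matrixDegrees F A, m ∣ d} =
        {m : ℕ | ∃ d ∈ matrixDegrees F B, m ∣ d} := by
  constructor
  · rintro ⟨e⟩
    rw [matrixDegrees_eq_of_algEquiv e]
  · intro h
    exact nonempty_algEquiv_of_matrixDegrees_dvd hA hB hdimA hdimB
      (fun d hd ↦ h.subset ⟨d, hd, dvd_rfl⟩) (fun d hd ↦ h.superset ⟨d, hd, dvd_rfl⟩)
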